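/- The pair (K₀, ≤) satisfies: (i) transitivity: if A, B, C ∈ K₀ and A ≤ B and B ≤ C, then A ≤ C; and (ii) if A, B, C ∈ K₀, A ≤ B, and C ⊆ B, then A ∩ C ≤ C. -/

import Mathlib

open scoped Classical

/-- A (one-sorted) linear space: a ternary collinearity relation that holds only of
pairwise distinct triples, is invariant under all permutations of its arguments, and
satisfies that two points determine at most one line. -/
structure IsLinearSpace {M : Type*} (R : M → M → M → Prop) : Prop where
  ne12 : ∀ {a b c : M}, R a b c → a ≠ b
  ne23 : ∀ {a b c : M}, R a b c → b ≠ c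
  ne13 : ∀ {a b c : M}, R a b c → a ≠ c
  swap12 : ∀ {a b c : M}, R a b c → R b a c
  swap23 : ∀ {a b c : M}, R a b c → R a c b
  line : ∀ {x y z w : M}, R x y z → R x y w → z ≠ w → R x w z

/-- `X` is an `R`-clique: every three pairwise distinct elements of `X` satisfy `R`. -/
def FinClique {M : Type*} (R : M → M → M → Prop) (X : Finset M) : Prop :=
  ∀ a ∈ X, ∀ b ∈ X, ∀ c ∈ X, a ≠ b → b ≠ c → a ≠ c → R a b c

/-- `ℓ` is a nontrivial line of the induced structure on `A`:
a maximal `R`-clique of `A` of size at least 3. -/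
def IsLineOf {M : Type*} (R : M → M → M → Prop) (A ℓ : Finset M) : Prop :=
  ℓ ⊆ A ∧ 3 ≤ ℓ.card ∧ FinClique R ℓ ∧
    ∀ ℓ' : Finset M, ℓ' ⊆ A → FinClique R ℓ' → ℓ ⊆ ℓ' → ℓ' = ℓ

/-- The (finite) set of nontrivial lines of the induced structure on `A`. -/
noncomputable def linesOf {M : Type*} (R : M → M → M → Prop) (A : Finset M) :
    Finset (Finset M) :=
  A.powerset.filter fun ℓ => IsLineOf R A ℓ

/-- The predimension `δ(A) = |A| - Σ_{ℓ ∈ L(A)} (|ℓ| - 2)`. -/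
noncomputable def delta {M : Type*} (R : M → M → M → Prop) (A : Finset M) : ℤ :=
  (A.card : ℤ) - ∑ ℓ ∈ linesOf R A, ((ℓ.card : ℤ) - 2)

/-- Membership in the class `K₀`: all subsets have nonnegative predimension. -/
def InK0 {M : Type*} (R : M → M → M → Prop) (A : Finset M) : Prop :=
  ∀ A' ⊆ A, 0 ≤ delta R A'

/-- `A ≤ B`: `A` is a strong substructure of `B`. -/
def Strong {M : Type*} (R : M → M → M → Prop) (A B : Finset M) : Prop :=
  A ⊆ B ∧ ∀ X : Finset M, A ⊆ X → X ⊆ B → delta R A ≤ delta R X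

/-- `C` is a primitive extension of `B`. -/
def PrimitiveExt {M : Type*} (R : M → M → M → Prop) (B C : Finset M) : Prop :=
  Strong R B C ∧ ¬ ∃ A₀ : Finset M, B ⊂ A₀ ∧ A₀ ⊂ C ∧ Strong R B A₀ ∧ Strong R A₀ C

/-- Two cliques sharing two distinct points have a clique as their union. -/
theorem FinClique.union {M : Type*} {R : M → M → M → Prop} (hR : IsLinearSpace R)
    {X Y : Finset M} (hX : FinClique R X) (hY : FinClique R Y) (h : 1 < (X ∩ Y).card) :
    FinClique R (X ∪ Y) := by
  obtain ⟨a, ha, b, hb, hab⟩ := Finset.one_lt_card.1 h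
  rw [Finset.mem_inter] at ha hb
  have key : ∀ x ∈ X ∪ Y, x ≠ a → x ≠ b → R a b x := by
    intro x hx hxa hxb
    rcases Finset.mem_union.1 hx with hx | hx
    · exact hX a ha.1 b hb.1 x hx hab hxb.symm hxa.symm
    · exact hY a ha.2 b hb.2 x hx hab hxb.symm hxa.symm
  have rot : ∀ {x y z}, R x y z → R y z x := fun h => hR.swap23 (hR.swap12 h)
  have left : ∀ x ∈ X ∪ Y, ∀ y ∈ X ∪ Y, x ≠ y → x ≠ a → y ≠ a → R a x y := by
    intro x hx y hy hxy hxa hya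
    by_cases hxb : x = b
    · subst hxb
      exact key y hy hya hxy.symm
    by_cases hyb : y = b
    · subst hyb
      exact hR.swap23 (key x hx hxa hxy)
    · exact hR.line (key y hy hya hyb) (key x hx hxa hxb) hxy.symm
  intro x hx y hy z hz hxy hyz hxz
  by_cases hxa : x = a
  · subst hxa
    exact left y hy z hz hyz hxy.symm hxz.symm
  by_cases hya : y = a
  · subst hya
    exact hR.swap12 (left x hx z hz hxz hxa hyz.symm)
  by_cases hza : z = a
  · subst hza
    exact rot (left x hx y hy hxy hxz hyz)
  · exact hR.line (hR.swap12 (left x hx z hz hxz hxa hza))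
      (hR.swap12 (left x hx y hy hxy hxa hya)) hyz.symm

theorem FinClique.mono {M : Type*} {R : M → M → M → Prop} {X Y : Finset M}
    (hY : FinClique R Y) (h : X ⊆ Y) : FinClique R X :=
  fun a ha b hb c hc => hY a (h ha) b (h hb) c (h hc)

/-- A clique with at least three points extends to a line. -/
theorem FinClique.exists_isLineOf {M : Type*} {R : M → M → M → Prop} {U X : Finset M}
    (hX : FinClique R X) (hXU : X ⊆ U) (h3 : 3 ≤ X.card) :
    ∃ L, IsLineOf R U L ∧ X ⊆ L := by
  obtain ⟨L, hL, hmax⟩ := Finset.exists_max_image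
    (U.powerset.filter fun L => FinClique R L ∧ X ⊆ L) Finset.card
    ⟨X, by simp [hX, hXU]⟩
  simp only [Finset.mem_filter, Finset.mem_powerset] at hL hmax
  obtain ⟨hLU, hLc, hXL⟩ := hL
  refine ⟨L, ⟨hLU, h3.trans (Finset.card_le_card hXL), hLc, fun L' hL'U hL'c hLL' => ?_⟩, hXL⟩
  exact (Finset.eq_of_subset_of_card_le hLL' (hmax L' ⟨hL'U, hL'c, hXL.trans hLL'⟩)).symm

theorem mem_linesOf {M : Type*} {R : M → M → M → Prop} {A ℓ : Finset M} :
    ℓ ∈ linesOf R A ↔ IsLineOf R A ℓ := by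
  simp only [linesOf, Finset.mem_filter, Finset.mem_powerset, and_iff_right_iff_imp]
  exact fun h => h.1

/-- A clique meeting a line in two distinct points is contained in it. -/
theorem IsLineOf.subset_of_finClique {M : Type*} {R : M → M → M → Prop}
    (hR : IsLinearSpace R) {U L X : Finset M} (hL : IsLineOf R U L) (hX : FinClique R X)
    (hXU : X ⊆ U) (h : 1 < (L ∩ X).card) : X ⊆ L :=
  Finset.union_eq_left.1 <| hL.2.2.2 _ (Finset.union_subset hL.1 hXU)
    (hL.2.2.1.union hR hX h) Finset.subset_union_left

/-- The lines of a substructure are the traces of the lines of the ambient structure. -/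
theorem sum_linesOf_eq_sum_trace {M : Type*} {R : M → M → M → Prop}
    (hR : IsLinearSpace R) {A U : Finset M} (hAU : A ⊆ U) :
    ∑ ℓ ∈ linesOf R A, ((ℓ.card : ℤ) - 2) =
      ∑ L ∈ linesOf R U, (((L ∩ A).card - 2 : ℕ) : ℤ) := by
  have hfilter : ∑ L ∈ (linesOf R U).filter (fun L => 3 ≤ (L ∩ A).card),
      (((L ∩ A).card - 2 : ℕ) : ℤ) =
      ∑ L ∈ linesOf R U, (((L ∩ A).card - 2 : ℕ) : ℤ) := by
    refine Finset.sum_filter_of_ne fun L _ h => ?_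
    omega
  rw [← hfilter]
  symm
  refine Finset.sum_bij (fun L _ => L ∩ A) ?_ ?_ ?_ ?_
  · intro L hL
    rw [Finset.mem_filter, mem_linesOf] at hL
    obtain ⟨hL, h3⟩ := hL
    refine mem_linesOf.2 ⟨Finset.inter_subset_right, h3,
      hL.2.2.1.mono Finset.inter_subset_left, fun X hXA hX hLX => ?_⟩
    refine (Finset.subset_inter (hL.subset_of_finClique hR hX (hXA.trans hAU) ?_) hXA).antisymm hLX
    have := Finset.card_le_card (Finset.subset_inter Finset.inter_subset_left hLX)
    omega
  · intro L₁ h₁ L₂ h₂ heq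
    rw [Finset.mem_filter, mem_linesOf] at h₁ h₂
    have hsub : L₁ ∩ A ⊆ L₁ ∩ L₂ := by
      refine Finset.subset_inter Finset.inter_subset_left ?_
      rw [show L₁ ∩ A = L₂ ∩ A from heq]
      exact Finset.inter_subset_left
    have hcard : 1 < (L₁ ∩ L₂).card := by
      have := Finset.card_le_card hsub
      omega
    exact (h₂.1.subset_of_finClique hR h₁.1.2.2.1 h₁.1.1
      (by rwa [Finset.inter_comm])).antisymm
      (h₁.1.subset_of_finClique hR h₂.1.2.2.1 h₂.1.1 hcard)
  · intro ℓ hℓ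
    rw [mem_linesOf] at hℓ
    obtain ⟨L, hL, hℓL⟩ := hℓ.2.2.1.exists_isLineOf (hℓ.1.trans hAU) hℓ.2.1
    have heq : L ∩ A = ℓ := hℓ.2.2.2 _ Finset.inter_subset_right
      (hL.2.2.1.mono Finset.inter_subset_left) (Finset.subset_inter hℓL hℓ.1)
    exact ⟨L, Finset.mem_filter.2 ⟨mem_linesOf.2 hL, heq ▸ hℓ.2.1⟩, heq⟩
  · intro L hL
    have := (Finset.mem_filter.1 hL).2
    omega

/-- The predimension is submodular. -/
theorem delta_union_add_delta_inter_le {M : Type*} {R : M → M → M → Prop}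
    (hR : IsLinearSpace R) (X Y : Finset M) :
    delta R (X ∪ Y) + delta R (X ∩ Y) ≤ delta R X + delta R Y := by
  have hcard := Finset.card_union_add_card_inter X Y
  have hsum : ∑ L ∈ linesOf R (X ∪ Y), (((L ∩ X).card - 2 : ℕ) : ℤ) +
      ∑ L ∈ linesOf R (X ∪ Y), (((L ∩ Y).card - 2 : ℕ) : ℤ) ≤
      ∑ L ∈ linesOf R (X ∪ Y), (((L ∩ (X ∪ Y)).card - 2 : ℕ) : ℤ) +
      ∑ L ∈ linesOf R (X ∪ Y), (((L ∩ (X ∩ Y)).card - 2 : ℕ) : ℤ) := by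
    rw [← Finset.sum_add_distrib, ← Finset.sum_add_distrib]
    refine Finset.sum_le_sum fun L _ => ?_
    have h := Finset.card_union_add_card_inter (L ∩ X) (L ∩ Y)
    rw [← Finset.inter_union_distrib_left, ← Finset.inter_inter_distrib_left] at h
    have hX : (L ∩ X).card ≤ (L ∩ (X ∪ Y)).card :=
      Finset.card_le_card (Finset.inter_subset_inter_left Finset.subset_union_left)
    have hY : (L ∩ Y).card ≤ (L ∩ (X ∪ Y)).card :=
      Finset.card_le_card (Finset.inter_subset_inter_left Finset.subset_union_right)
    omega
  have hinter : X ∩ Y ⊆ X ∪ Y := Finset.inter_subset_left.trans Finset.subset_union_left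
  unfold delta
  rw [sum_linesOf_eq_sum_trace hR (Finset.Subset.refl (X ∪ Y)),
    sum_linesOf_eq_sum_trace hR hinter,
    sum_linesOf_eq_sum_trace hR (Finset.subset_union_left : X ⊆ X ∪ Y),
    sum_linesOf_eq_sum_trace hR (Finset.subset_union_right : Y ⊆ X ∪ Y)]
  omega

/-- The pair `(K₀, ≤)` satisfies: (i) transitivity of strong substructure; and
(ii) if `A ≤ B` and `C ⊆ B` then `A ∩ C ≤ C`. -/
theorem strong_trans_and_inter {M : Type*} (R : M → M → M → Prop)
    (hLS : IsLinearSpace R) :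
    (∀ A B C : Finset M, InK0 R A → InK0 R B → InK0 R C →
      Strong R A B → Strong R B C → Strong R A C) ∧
    (∀ A B C : Finset M, InK0 R A → InK0 R B → InK0 R C →
      Strong R A B → C ⊆ B → Strong R (A ∩ C) C) := by
  constructor
  · intro A B C _ _ _ hAB hBC
    refine ⟨hAB.1.trans hBC.1, fun X hAX hXC => ?_⟩
    have h := delta_union_add_delta_inter_le hLS X B
    have h₁ := hBC.2 (X ∪ B) Finset.subset_union_right (Finset.union_subset hXC hBC.1)
    have h₂ := hAB.2 (X ∩ B) (Finset.subset_inter hAX hAB.1) Finset.inter_subset_right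
    omega
  · intro A B C _ _ _ hAB hCB
    refine ⟨Finset.inter_subset_right, fun X hX hXC => ?_⟩
    have h := delta_union_add_delta_inter_le hLS X A
    have h₁ := hAB.2 (X ∪ A) Finset.subset_union_right
      (Finset.union_subset (hXC.trans hCB) hAB.1)
    have heq : X ∩ A = A ∩ C :=
      (Finset.subset_inter Finset.inter_subset_right
        (Finset.inter_subset_left.trans hXC)).antisymm
        (Finset.subset_inter hX Finset.inter_subset_left)
    rw [heq] at h
    omega
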